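/- Let U = {(x,y) ∈ ℝ² : x + y² ≠ 0 and 3x − y² ≠ 0}. Consider on U the two metrics g₁ = (y² + x)·dxdy and g₃ = ((y² + x)/(3x − y²)⁶)·( 9(y² + x)·dx² − 4y(9x + y²)·dxdy + 12x(y² + x)·dy² ). Then det(g₃) = 4(x + y²)²·(3x − y²)^{−9} ≠ 0 on U, and g₁ and g₃ are projectively equivalent on U: the four functions −Γ²₁₁, Γ¹₁₁ − 2Γ²₁₂, 2Γ¹₁₂ − Γ²₂₂, Γ¹₂₂ computed from the Christoffel symbols of g₁ equal the corresponding four functions computed from the Christoffel symbols of g₃, at every point of U. -/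

import Mathlib

open Real Matrix

/-- Partial derivative in direction `i` (0 = x, 1 = y) of a function on `ℝ × ℝ`. -/
noncomputable def pd (i : Fin 2) (f : ℝ × ℝ → ℝ) (p : ℝ × ℝ) : ℝ :=
  fderiv ℝ f p (if i = 0 then (1, 0) else (0, 1))

/-- Christoffel symbols `Γ^i_{jk}` of a 2×2-matrix valued metric on `ℝ × ℝ`. -/
noncomputable def christoffel (g : ℝ × ℝ → Matrix (Fin 2) (Fin 2) ℝ)
    (i j k : Fin 2) (p : ℝ × ℝ) : ℝ :=
  (1 / 2) * ∑ l : Fin 2, (g p)⁻¹ i l *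
    (pd j (fun q => g q l k) p + pd k (fun q => g q j l) p - pd l (fun q => g q j k) p)

/-- Matrix of the metric `g₁ = (y² + x) dxdy`. -/
noncomputable def G₁ (p : ℝ × ℝ) : Matrix (Fin 2) (Fin 2) ℝ :=
  !![0, (p.2 ^ 2 + p.1) / 2; (p.2 ^ 2 + p.1) / 2, 0]

/-- Matrix of the metric
`g₃ = ((y²+x)/(3x−y²)⁶)(9(y²+x)dx² − 4y(9x+y²)dxdy + 12x(y²+x)dy²)`. -/
noncomputable def G₃ (p : ℝ × ℝ) : Matrix (Fin 2) (Fin 2) ℝ :=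
  ((p.2 ^ 2 + p.1) / (3 * p.1 - p.2 ^ 2) ^ 6) •
    !![9 * (p.2 ^ 2 + p.1), -(2 * p.2 * (9 * p.1 + p.2 ^ 2));
       -(2 * p.2 * (9 * p.1 + p.2 ^ 2)), 12 * p.1 * (p.2 ^ 2 + p.1)]

/-- The domain `U = {x + y² ≠ 0, 3x − y² ≠ 0}`. -/
def Dom : Set (ℝ × ℝ) := {p | p.1 + p.2 ^ 2 ≠ 0 ∧ 3 * p.1 - p.2 ^ 2 ≠ 0}

/-- `f` is differentiable at `p` with partial derivatives `a`, `b`. -/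
def HP (f : ℝ × ℝ → ℝ) (a b : ℝ) (p : ℝ × ℝ) : Prop :=
  HasFDerivAt f (a • ContinuousLinearMap.fst ℝ ℝ ℝ + b • ContinuousLinearMap.snd ℝ ℝ ℝ) p

theorem HP.pd0 {f : ℝ × ℝ → ℝ} {a b : ℝ} {p : ℝ × ℝ} (h : HP f a b p) : pd 0 f p = a := by
  unfold pd
  rw [HasFDerivAt.fderiv h]
  simp

theorem HP.pd1 {f : ℝ × ℝ → ℝ} {a b : ℝ} {p : ℝ × ℝ} (h : HP f a b p) : pd 1 f p = b := by
  unfold pd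
  rw [HasFDerivAt.fderiv h]
  simp

theorem HP.poly {f : ℝ × ℝ → ℝ} {p : ℝ × ℝ} (a b : ℝ) (hf : DifferentiableAt ℝ f p)
    (h0 : HasDerivAt (fun t => f (t, p.2)) a p.1) (h1 : HasDerivAt (fun t => f (p.1, t)) b p.2) :
    HP f a b p := by
  have h := hf.hasFDerivAt
  have e0 : HasDerivAt (fun t : ℝ => (t, p.2)) ((1 : ℝ), (0 : ℝ)) p.1 :=
    (hasDerivAt_id p.1).prodMk (hasDerivAt_const p.1 p.2)
  have e1 : HasDerivAt (fun t : ℝ => (p.1, t)) ((0 : ℝ), (1 : ℝ)) p.2 :=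
    (hasDerivAt_const p.2 p.1).prodMk (hasDerivAt_id p.2)
  have k0 := (HasFDerivAt.comp_hasDerivAt p.1 (l := f) (f := fun t : ℝ => (t, p.2)) h e0).unique h0
  have k1 := (HasFDerivAt.comp_hasDerivAt p.2 (l := f) (f := fun t : ℝ => (p.1, t)) h e1).unique h1
  unfold HP
  refine HasFDerivAt.congr_fderiv h ?_
  ext <;> simp [k0, k1]

theorem HP.divw {N : ℝ × ℝ → ℝ} {a b : ℝ} {p : ℝ × ℝ} (h : HP N a b p)
    (hw : 3 * p.1 - p.2 ^ 2 ≠ 0) :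
    HP (fun q => N q / (3 * q.1 - q.2 ^ 2) ^ 6)
      ((a * (3 * p.1 - p.2 ^ 2) - 18 * N p) / (3 * p.1 - p.2 ^ 2) ^ 7)
      ((b * (3 * p.1 - p.2 ^ 2) + 12 * p.2 * N p) / (3 * p.1 - p.2 ^ 2) ^ 7) p := by
  have hN : DifferentiableAt ℝ N p := HasFDerivAt.differentiableAt h
  have e0 : HasDerivAt (fun t : ℝ => (t, p.2)) ((1 : ℝ), (0 : ℝ)) p.1 :=
    (hasDerivAt_id p.1).prodMk (hasDerivAt_const p.1 p.2)
  have e1 : HasDerivAt (fun t : ℝ => (p.1, t)) ((0 : ℝ), (1 : ℝ)) p.2 :=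
    (hasDerivAt_const p.2 p.1).prodMk (hasDerivAt_id p.2)
  have k0 := HasFDerivAt.comp_hasDerivAt p.1 (l := N) (f := fun t : ℝ => (t, p.2)) h e0
  have k1 := HasFDerivAt.comp_hasDerivAt p.2 (l := N) (f := fun t : ℝ => (p.1, t)) h e1
  have hw6 : (3 * p.1 - p.2 ^ 2) ^ 6 ≠ 0 := pow_ne_zero 6 hw
  refine HP.poly _ _ (by fun_prop (disch := assumption)) ?_ ?_
  · have d := k0.div (((((hasDerivAt_id p.1).const_mul 3).sub_const (p.2 ^ 2))).pow 6) hw6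
    refine HasDerivAt.congr_deriv d ?_
    simp
    field_simp
    ring
  · have d := k1.div ((((hasDerivAt_id p.2).pow 2).const_sub (3 * p.1)).pow 6) hw6
    refine HasDerivAt.congr_deriv d ?_
    simp
    field_simp
    ring

theorem HP.add {f g : ℝ × ℝ → ℝ} {a b c d : ℝ} {p : ℝ × ℝ} (hf : HP f a b p) (hg : HP g c d p) :
    HP (fun q => f q + g q) (a + c) (b + d) p := by
  unfold HP at *
  refine HasFDerivAt.congr_fderiv (HasFDerivAt.add hf hg) ?_
  ext <;> simp

theorem HP.mul {f g : ℝ × ℝ → ℝ} {a b c d : ℝ} {p : ℝ × ℝ} (hf : HP f a b p) (hg : HP g c d p) :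
    HP (fun q => f q * g q) (a * g p + f p * c) (b * g p + f p * d) p := by
  unfold HP at *
  refine HasFDerivAt.congr_fderiv (HasFDerivAt.mul hf hg) ?_
  ext <;> simp <;> ring

theorem HP.const (c : ℝ) (p : ℝ × ℝ) : HP (fun _ => c) 0 0 p := by
  unfold HP
  refine HasFDerivAt.congr_fderiv (hasFDerivAt_const c p) ?_
  ext <;> simp

theorem HP.x (p : ℝ × ℝ) : HP (fun q => q.1) 1 0 p := by
  unfold HP
  refine HasFDerivAt.congr_fderiv hasFDerivAt_fst ?_
  ext <;> simp

theorem HP.y (p : ℝ × ℝ) : HP (fun q => q.2) 0 1 p := by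
  unfold HP
  refine HasFDerivAt.congr_fderiv hasFDerivAt_snd ?_
  ext <;> simp

theorem HP.congr {f g : ℝ × ℝ → ℝ} {a b c d : ℝ} {p : ℝ × ℝ} (hf : HP f a b p)
    (h : ∀ q, g q = f q) (h1 : c = a) (h2 : d = b) : HP g c d p := by
  have : g = f := funext h
  subst this h1 h2
  exact hf

theorem HP.s (p : ℝ × ℝ) : HP (fun q => q.2 ^ 2 + q.1) 1 (2 * p.2) p :=
  (((HP.y p).mul (HP.y p)).add (HP.x p)).congr (fun q => by ring) (by ring) (by ring)

theorem hG1 (p : ℝ × ℝ) : HP (fun q => (q.2 ^ 2 + q.1) / 2) (1 / 2) p.2 p :=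
  ((HP.s p).mul (HP.const (1 / 2) p)).congr (fun q => by ring) (by ring) (by ring)

theorem det3 (p : ℝ × ℝ) (hw : 3 * p.1 - p.2 ^ 2 ≠ 0) :
    (G₃ p).det = 4 * (p.1 + p.2 ^ 2) ^ 2 / (3 * p.1 - p.2 ^ 2) ^ 9 := by
  simp [G₃, Matrix.det_fin_two]
  generalize hW : 3 * p.1 - p.2 ^ 2 = w at *
  field_simp
  rw [← hW]
  ring

/-- On `U`, `det g₃ = 4(x + y²)²(3x − y²)^{−9} ≠ 0`, and the metrics `g₁` and `g₃` are
projectively equivalent: the four coefficients of their projective connections coincide. -/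
theorem stmt_18 :
    ∀ p ∈ Dom,
      ((G₃ p).det = 4 * (p.1 + p.2 ^ 2) ^ 2 * (3 * p.1 - p.2 ^ 2) ^ (-9 : ℤ) ∧
        (G₃ p).det ≠ 0) ∧
      (-(christoffel G₁ 1 0 0 p) = -(christoffel G₃ 1 0 0 p) ∧
        christoffel G₁ 0 0 0 p - 2 * christoffel G₁ 1 0 1 p
          = christoffel G₃ 0 0 0 p - 2 * christoffel G₃ 1 0 1 p ∧
        2 * christoffel G₁ 0 0 1 p - christoffel G₁ 1 1 1 p
          = 2 * christoffel G₃ 0 0 1 p - christoffel G₃ 1 1 1 p ∧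
        christoffel G₁ 0 1 1 p = christoffel G₃ 0 1 1 p) := by
  rintro ⟨x, y⟩ ⟨hs, hw⟩
  simp only at hs hw
  have hs' : y ^ 2 + x ≠ 0 := by rwa [add_comm]
  have hd := det3 (x, y) hw
  simp only at hd
  have hd0 : (G₃ (x, y)).det ≠ 0 := by
    rw [hd]; positivity
  refine ⟨⟨?_, hd0⟩, ?_⟩
  · rw [hd, _root_.zpow_neg]; rfl
  have a00 : (fun q => G₁ q 0 0) = fun _ => (0 : ℝ) := by funext q; simp [G₁]
  have a01 : (fun q => G₁ q 0 1) = fun q => (q.2 ^ 2 + q.1) / 2 := by funext q; simp [G₁]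
  have a10 : (fun q => G₁ q 1 0) = fun q => (q.2 ^ 2 + q.1) / 2 := by funext q; simp [G₁]
  have a11 : (fun q => G₁ q 1 1) = fun _ => (0 : ℝ) := by funext q; simp [G₁]
  have b00 := ((((HP.s (x, y)).mul (HP.s (x, y))).mul (HP.const 9 (x, y))).divw hw).congr (g := fun q => G₃ q 0 0)
    (fun q => by simp [G₃]; ring) rfl rfl
  have b01 := ((((HP.s (x, y)).mul (((HP.const 9 (x, y)).mul (HP.x (x, y))).add ((HP.y (x, y)).mul (HP.y (x, y))))).mul     ((HP.const (-2) (x, y)).mul (HP.y (x, y)))).divw hw).congr (g := fun q => G₃ q 0 1)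
    (fun q => by simp [G₃]; ring) rfl rfl
  have b10 := ((((HP.s (x, y)).mul (((HP.const 9 (x, y)).mul (HP.x (x, y))).add ((HP.y (x, y)).mul (HP.y (x, y))))).mul     ((HP.const (-2) (x, y)).mul (HP.y (x, y)))).divw hw).congr (g := fun q => G₃ q 1 0)
    (fun q => by simp [G₃]; ring) rfl rfl
  have b11 := ((((HP.s (x, y)).mul (HP.s (x, y))).mul ((HP.const 12 (x, y)).mul (HP.x (x, y)))).divw hw).congr (g := fun q => G₃ q 1 1)
    (fun q => by simp [G₃]; ring) rfl rfl
  have i1 : (G₁ (x, y))⁻¹ = !![0, 2 / (y ^ 2 + x); 2 / (y ^ 2 + x), 0] := by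
    apply Matrix.inv_eq_right_inv
    ext i j
    fin_cases i <;> fin_cases j <;> simp [G₁, Matrix.mul_apply] <;> field_simp
  have i3 : (G₃ (x, y))⁻¹ = ((3 * x - y ^ 2) ^ 3 / (4 * (y ^ 2 + x))) •
      !![12 * x * (y ^ 2 + x), 2 * y * (9 * x + y ^ 2);
         2 * y * (9 * x + y ^ 2), 9 * (y ^ 2 + x)] := by
    apply Matrix.inv_eq_right_inv
    ext i j
    fin_cases i <;> fin_cases j <;> simp [G₃, Matrix.mul_apply] <;>
      generalize hW : 3 * x - y ^ 2 = w at * <;> field_simp <;> (try rw [← hW]) <;> ring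
  simp only [christoffel, Fin.sum_univ_two, i1, i3, a00, a01, a10, a11,
    (HP.const 0 (x, y)).pd0, (HP.const 0 (x, y)).pd1, (hG1 (x, y)).pd0, (hG1 (x, y)).pd1,
    b00.pd0, b00.pd1, b01.pd0, b01.pd1, b10.pd0, b10.pd1, b11.pd0, b11.pd1]
  refine ⟨?_, ?_, ?_, ?_⟩ <;> simp <;> clear b00 b01 b10 b11 i3 hd <;>
    generalize hW : 3 * x - y ^ 2 = w at * <;> field_simp <;> (try rw [← hW]) <;> ring
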